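/- For M = [L, U] with L < 0 < U and any Y₁,...: the supremum over probability measures G on M of (Σ_{k≥1} Y_k κ_k(G)/√(k!)) / (Σ_{k≥1} κ_k(G)²/k!)^{1/2} is bounded below by sup over α ∈ ℝ and G with κ₁ replaced: specifically, sup_G of the ratio equals sup_{α ∈ ℝ} sup_G (αY₁ + Σ_{k≥2} Y_k κ_k(G)/√(k!)) / (α² + Σ_{k≥2} κ_k(G)²/k!)^{1/2}, when Y₂, Y₃, ... satisfy Σ Y_k²/k! < ∞. -/

import Mathlib

open MeasureTheory

open Filter Topology in
lemma aux_lin (c : ℕ → ℝ) (C : ℝ) (hc : ∀ k, |c k| ≤ C) :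
    Tendsto (fun x : ℝ => ∑' k : ℕ, c k * x ^ (k + 1)) (𝓝 0) (𝓝 0) := by
  have h := tendsto_tsum_of_dominated_convergence (𝓕 := 𝓝 (0 : ℝ))
    (f := fun (x : ℝ) (k : ℕ) => c k * x ^ (k + 1)) (g := fun _ => (0 : ℝ))
    (bound := fun k => C * (1 / 2 : ℝ) ^ (k + 1)) ?_ ?_ ?_
  · simpa using h
  · have := (summable_geometric_of_lt_one (r := (1 / 2 : ℝ)) (by norm_num) (by norm_num))
    exact ((summable_nat_add_iff 1).2 this).mul_left C
  · intro k
    have : Continuous fun x : ℝ => c k * x ^ (k + 1) := by fun_prop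
    simpa using this.tendsto 0
  · have : ∀ᶠ x : ℝ in 𝓝 0, |x| < 1 / 2 := by
      have hc : Continuous fun x : ℝ => |x| := continuous_abs
      exact (hc.tendsto 0).eventually (gt_mem_nhds (by norm_num))
    filter_upwards [this] with x hx k
    rw [Real.norm_eq_abs, abs_mul, abs_pow]
    have : 0 ≤ C := (abs_nonneg _).trans (hc k)
    gcongr
    exact hc k

lemma aux_summ_bound (R d : ℝ) :
    Summable fun k : ℕ => (R ^ (k + 2) + d) ^ 2 / (Nat.factorial (k + 2) : ℝ) := by
  have h1 := Real.summable_pow_div_factorial (R ^ 2)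
  have h2 := (Real.summable_pow_div_factorial R).mul_left (2 * d)
  have h3 := (Real.summable_pow_div_factorial 1).mul_left (d ^ 2)
  refine ((summable_nat_add_iff 2).2 ((h1.add h2).add h3)).congr fun k => ?_
  simp only [one_pow]
  ring

open Filter Topology in
lemma aux_sq (a : ℕ → ℝ) (R d : ℝ) (ha : ∀ k, |a k| ≤ R ^ (k + 2)) :
    Tendsto (fun x : ℝ => ∑' k : ℕ, (a k + d * x ^ (k + 1)) ^ 2 / (Nat.factorial (k + 2) : ℝ))
      (𝓝 0) (𝓝 (∑' k : ℕ, (a k) ^ 2 / (Nat.factorial (k + 2) : ℝ))) := by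
  refine tendsto_tsum_of_dominated_convergence (aux_summ_bound R |d|) ?_ ?_
  · intro k
    have : Continuous fun x : ℝ => (a k + d * x ^ (k + 1)) ^ 2 / (Nat.factorial (k + 2) : ℝ) := by
      fun_prop
    simpa using this.tendsto 0
  · have : ∀ᶠ x : ℝ in 𝓝 0, |x| < 1 := by
      have hc : Continuous fun x : ℝ => |x| := continuous_abs
      exact (hc.tendsto 0).eventually (gt_mem_nhds (by norm_num))
    filter_upwards [this] with x hx k
    rw [Real.norm_eq_abs, abs_div, abs_pow, Nat.abs_cast]
    have h2 : |d * x ^ (k + 1)| ≤ |d| := by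
      rw [abs_mul, abs_pow]
      exact mul_le_of_le_one_right (abs_nonneg _) (pow_le_one₀ (abs_nonneg _) hx.le)
    have h1 : |a k + d * x ^ (k + 1)| ≤ R ^ (k + 2) + |d| :=
      (abs_add_le _ _).trans (add_le_add (ha k) h2)
    gcongr

lemma aux_ae {L U : ℝ} {G : Measure ℝ} (hG : G (Set.Icc L U)ᶜ = 0) :
    ∀ᵐ x ∂G, |x| ≤ max |L| |U| := by
  have : ∀ᵐ x ∂G, x ∈ Set.Icc L U := hG
  filter_upwards [this] with x hx
  exact abs_le_max_abs_abs hx.1 hx.2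

lemma aux_int {L U : ℝ} {G : Measure ℝ} [IsProbabilityMeasure G] (hG : G (Set.Icc L U)ᶜ = 0)
    (n : ℕ) : Integrable (fun x : ℝ => x ^ n) G := by
  refine Integrable.of_bound (by fun_prop) ((max |L| |U|) ^ n) ?_
  filter_upwards [aux_ae hG] with x hx
  rw [Real.norm_eq_abs, abs_pow]
  gcongr

lemma aux_mom {L U : ℝ} {G : Measure ℝ} [IsProbabilityMeasure G] (hG : G (Set.Icc L U)ᶜ = 0)
    (n : ℕ) : |∫ μ, μ ^ n ∂G| ≤ (max |L| |U|) ^ n := by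
  have := norm_integral_le_of_norm_le_const (μ := G) (f := fun x : ℝ => x ^ n)
    (C := (max |L| |U|) ^ n) ?_
  · simpa using this
  filter_upwards [aux_ae hG] with x hx
  rw [Real.norm_eq_abs, abs_pow]
  gcongr

lemma aux_dirac {L U : ℝ} {G : Measure ℝ} [IsProbabilityMeasure G] (hG : G (Set.Icc L U)ᶜ = 0)
    (h : ∫ μ, μ ^ 2 ∂G = 0) : G = Measure.dirac 0 := by
  rw [integral_eq_zero_iff_of_nonneg (fun x => sq_nonneg x) (aux_int hG 2)] at h
  have h' : (fun x : ℝ => x) =ᵐ[G] fun _ => 0 := by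
    filter_upwards [h] with x hx
    simpa using hx
  have : Measure.map (fun x : ℝ => x) G = Measure.map (fun _ => (0 : ℝ)) G := Measure.map_congr h'
  rw [Measure.map_id', Measure.map_const] at this
  simpa using this

lemma aux_summ_sq {L U : ℝ} {G : Measure ℝ} [IsProbabilityMeasure G]
    (hG : G (Set.Icc L U)ᶜ = 0) :
    Summable fun k : ℕ => (∫ μ, μ ^ (k + 2) ∂G) ^ 2 / (Nat.factorial (k + 2) : ℝ) := by
  refine Summable.of_nonneg_of_le (fun k => by positivity) (fun k => ?_)
    (aux_summ_bound (max |L| |U|) 0)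
  rw [← sq_abs, add_zero]
  have := aux_mom hG (k + 2)
  gcongr

/-- Numerator, denominator splitting for the first set. -/
lemma aux_split_den {L U : ℝ} {G : Measure ℝ} [IsProbabilityMeasure G]
    (hG : G (Set.Icc L U)ᶜ = 0) :
    ∑' k : ℕ, (∫ μ, μ ^ (k + 1) ∂G) ^ 2 / (Nat.factorial (k + 1) : ℝ)
      = (∫ μ, μ ∂G) ^ 2 +
        ∑' k : ℕ, (∫ μ, μ ^ (k + 2) ∂G) ^ 2 / (Nat.factorial (k + 2) : ℝ) := by
  have h : Summable fun k : ℕ => (∫ μ, μ ^ (k + 1) ∂G) ^ 2 / (Nat.factorial (k + 1) : ℝ) :=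
    (summable_nat_add_iff 1).1 (aux_summ_sq hG)
  rw [h.tsum_eq_zero_add]
  simp

lemma aux_split_num (Y : ℕ → ℝ) {G : Measure ℝ}
    (h : Summable fun k : ℕ => Y (k + 2) * (∫ μ, μ ^ (k + 2) ∂G)
        / Real.sqrt (Nat.factorial (k + 2))) :
    ∑' k : ℕ, Y (k + 1) * (∫ μ, μ ^ (k + 1) ∂G) / Real.sqrt (Nat.factorial (k + 1))
      = (∫ μ, μ ∂G) * Y 1 + ∑' k : ℕ, Y (k + 2) * (∫ μ, μ ^ (k + 2) ∂G)
          / Real.sqrt (Nat.factorial (k + 2)) := by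
  have h : Summable fun k : ℕ => Y (k + 1) * (∫ μ, μ ^ (k + 1) ∂G)
      / Real.sqrt (Nat.factorial (k + 1)) := (summable_nat_add_iff 1).1 h
  rw [h.tsum_eq_zero_add]
  simp [mul_comm]

lemma aux_coef (Y : ℕ → ℝ)
    (hY : Summable fun k : ℕ => (Y (k + 2)) ^ 2 / (Nat.factorial (k + 2) : ℝ)) :
    ∃ C, ∀ k, |Y (k + 2) / Real.sqrt (Nat.factorial (k + 2))| ≤ C := by
  refine ⟨Real.sqrt (∑' k : ℕ, (Y (k + 2)) ^ 2 / (Nat.factorial (k + 2) : ℝ)), fun k => ?_⟩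
  apply Real.abs_le_sqrt
  rw [div_pow, Real.sq_sqrt (by positivity)]
  exact hY.le_tsum k (fun j _ => by positivity)

def setA (L U : ℝ) (Y : ℕ → ℝ) : Set ℝ :=
  {r : ℝ | ∃ G : Measure ℝ, IsProbabilityMeasure G ∧ G (Set.Icc L U)ᶜ = 0 ∧
        G ≠ Measure.dirac 0 ∧
        r = (∑' k : ℕ, Y (k + 1) * (∫ μ, μ ^ (k + 1) ∂G)
                / Real.sqrt (Nat.factorial (k + 1)))
            / Real.sqrt (∑' k : ℕ, (∫ μ, μ ^ (k + 1) ∂G) ^ 2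
                / (Nat.factorial (k + 1) : ℝ))}

def setB (L U : ℝ) (Y : ℕ → ℝ) : Set ℝ :=
  {r : ℝ | ∃ (α : ℝ) (G : Measure ℝ), IsProbabilityMeasure G ∧
          G (Set.Icc L U)ᶜ = 0 ∧ (α ≠ 0 ∨ G ≠ Measure.dirac 0) ∧
          r = (α * Y 1 + ∑' k : ℕ, Y (k + 2) * (∫ μ, μ ^ (k + 2) ∂G)
                  / Real.sqrt (Nat.factorial (k + 2)))
              / Real.sqrt (α ^ 2 + ∑' k : ℕ, (∫ μ, μ ^ (k + 2) ∂G) ^ 2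
                  / (Nat.factorial (k + 2) : ℝ))}

/-- One perturbed mixture lies in the first set. -/
lemma aux_mem (L U : ℝ) (Y : ℕ → ℝ)
    (hY : Summable fun k : ℕ => (Y (k + 2)) ^ 2 / (Nat.factorial (k + 2) : ℝ))
    (α : ℝ) (G : Measure ℝ) [IsProbabilityMeasure G] (hG : G (Set.Icc L U)ᶜ = 0)
    (hne : α ≠ 0 ∨ G ≠ Measure.dirac 0)
    (hs : Summable fun k : ℕ => Y (k + 2) * (∫ μ, μ ^ (k + 2) ∂G)
        / Real.sqrt (Nat.factorial (k + 2)))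
    (d : ℝ) (hd : d = α - ∫ μ, μ ∂G) (x : ℝ) (hx0 : x ≠ 0) (hx1 : |x| < 1)
    (hxm : x ∈ Set.Icc L U) (hsign : |x| * d = |d| * x) :
    (α * Y 1 + (∑' k : ℕ, Y (k + 2) * (∫ μ, μ ^ (k + 2) ∂G)
                  / Real.sqrt (Nat.factorial (k + 2)))
        + d * ∑' k : ℕ, (Y (k + 2) / Real.sqrt (Nat.factorial (k + 2))) * x ^ (k + 1))
      / Real.sqrt (α ^ 2 + ∑' k : ℕ, ((∫ μ, μ ^ (k + 2) ∂G) + d * x ^ (k + 1)) ^ 2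
                  / (Nat.factorial (k + 2) : ℝ)) ∈ setA L U Y := by
  have hxp : 0 < |x| := abs_pos.2 hx0
  set t : ℝ := |x| / (|x| + |d|) with ht
  have hden : 0 < |x| + |d| := by positivity
  have htpos : 0 < t := by positivity
  have ht1 : t ≤ 1 := by
    rw [ht, div_le_one hden]; linarith [abs_nonneg d]
  have htx : (1 - t) * x = t * d := by
    rw [ht]; field_simp; linarith
  set G' : Measure ℝ := ENNReal.ofReal t • G + ENNReal.ofReal (1 - t) • Measure.dirac x with hG'
  have hP : IsProbabilityMeasure G' := by
    constructor
    simp only [hG', Measure.add_apply, Measure.smul_apply, measure_univ, smul_eq_mul, mul_one]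
    rw [← ENNReal.ofReal_add htpos.le (by linarith)]
    simp
  have hsupp : G' (Set.Icc L U)ᶜ = 0 := by
    simp only [hG', Measure.add_apply, Measure.smul_apply, hG, smul_eq_mul, mul_zero, zero_add]
    rw [Measure.dirac_apply' _ measurableSet_Icc.compl]
    simp [hxm]
  have hmom : ∀ n : ℕ, ∫ μ, μ ^ n ∂G' = t * (∫ μ, μ ^ n ∂G) + (1 - t) * x ^ n := by
    intro n
    have hi : Integrable (fun y : ℝ => y ^ n) (Measure.dirac x) :=
      integrable_dirac (by simp [enorm_lt_top])
    rw [hG', integral_add_measure ((aux_int hG n).smul_measure ENNReal.ofReal_ne_top)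
      (hi.smul_measure ENNReal.ofReal_ne_top), integral_smul_measure, integral_smul_measure,
      integral_dirac, ENNReal.toReal_ofReal htpos.le, ENNReal.toReal_ofReal (by linarith)]
    simp
  have hmom2 : ∀ k : ℕ, ∫ μ, μ ^ (k + 2) ∂G' = t * ((∫ μ, μ ^ (k + 2) ∂G) + d * x ^ (k + 1)) := by
    intro k
    rw [hmom, pow_succ x (k + 1)]
    linear_combination x ^ (k + 1) * htx
  have hmom1 : ∫ μ, μ ∂G' = t * α := by
    have := hmom 1
    simp only [pow_one] at this
    rw [this, htx, hd]; ring
  obtain ⟨C, hC⟩ := aux_coef Y hY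
  have hsx : Summable fun k : ℕ => (Y (k + 2) / Real.sqrt (Nat.factorial (k + 2))) * x ^ (k + 1) := by
    have hgeo := ((summable_nat_add_iff 1).2
      (summable_geometric_of_lt_one (abs_nonneg x) hx1)).mul_left C
    refine Summable.of_norm_bounded hgeo fun k => ?_
    rw [Real.norm_eq_abs, abs_mul, abs_pow]
    gcongr
    exact hC k
  have hsum' := hs.add (hsx.mul_left d)
  have hterm : ∀ k : ℕ, Y (k + 2) * (∫ μ, μ ^ (k + 2) ∂G') / Real.sqrt (Nat.factorial (k + 2))
      = t * (Y (k + 2) * (∫ μ, μ ^ (k + 2) ∂G) / Real.sqrt (Nat.factorial (k + 2))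
        + d * ((Y (k + 2) / Real.sqrt (Nat.factorial (k + 2))) * x ^ (k + 1))) := by
    intro k; rw [hmom2]; ring
  refine ⟨G', hP, hsupp, ?_, ?_⟩
  · intro h0
    have e1 : t * α = 0 := by rw [← hmom1, h0]; simp
    have e2 : t * (∫ μ, μ ^ 2 ∂G) + (1 - t) * x ^ 2 = 0 := by rw [← hmom, h0]; simp
    have ha : α = 0 := (mul_eq_zero.1 e1).resolve_left htpos.ne'
    have hk : 0 ≤ ∫ μ, μ ^ 2 ∂G := integral_nonneg fun y => sq_nonneg y
    have h2 : 0 ≤ (1 - t) * x ^ 2 := mul_nonneg (by linarith) (sq_nonneg x)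
    have h3 : t * (∫ μ, μ ^ 2 ∂G) = 0 := by
      have := mul_nonneg htpos.le hk
      linarith
    have hk0 := (mul_eq_zero.1 h3).resolve_left htpos.ne'
    rcases hne with h | h
    · exact h ha
    · exact h (aux_dirac hG hk0)
  · have hs' : Summable fun k : ℕ => Y (k + 2) * (∫ μ, μ ^ (k + 2) ∂G')
        / Real.sqrt (Nat.factorial (k + 2)) := by
      simp_rw [hterm]
      exact hsum'.mul_left t
    rw [aux_split_den hsupp, aux_split_num Y hs', hmom1]
    simp_rw [hterm]
    rw [tsum_mul_left, hs.tsum_add (hsx.mul_left d), tsum_mul_left]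
    simp_rw [hmom2, mul_pow, mul_div_assoc]
    rw [tsum_mul_left, ← mul_add, Real.sqrt_mul (sq_nonneg t), Real.sqrt_sq htpos.le,
      mul_assoc t α, ← mul_add, mul_div_mul_left _ _ htpos.ne', add_assoc]

open Filter Topology in
lemma aux_limit (L U : ℝ) (hL : L < 0) (hU : 0 < U) (Y : ℕ → ℝ)
    (hY : Summable fun k : ℕ => (Y (k + 2)) ^ 2 / (Nat.factorial (k + 2) : ℝ))
    (α : ℝ) (G : Measure ℝ) [IsProbabilityMeasure G] (hG : G (Set.Icc L U)ᶜ = 0)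
    (hne : α ≠ 0 ∨ G ≠ Measure.dirac 0)
    (hs : Summable fun k : ℕ => Y (k + 2) * (∫ μ, μ ^ (k + 2) ∂G)
        / Real.sqrt (Nat.factorial (k + 2))) (b : ℝ) (hb : b ∈ upperBounds (setA L U Y)) :
    (α * Y 1 + ∑' k : ℕ, Y (k + 2) * (∫ μ, μ ^ (k + 2) ∂G)
                  / Real.sqrt (Nat.factorial (k + 2)))
              / Real.sqrt (α ^ 2 + ∑' k : ℕ, (∫ μ, μ ^ (k + 2) ∂G) ^ 2
                  / (Nat.factorial (k + 2) : ℝ)) ≤ b := by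
  set d : ℝ := α - ∫ μ, μ ∂G with hd
  obtain ⟨C, hC⟩ := aux_coef Y hY
  have l1 := aux_lin (fun k => Y (k + 2) / Real.sqrt (Nat.factorial (k + 2))) C hC
  have l2 := aux_sq (fun k => ∫ μ, μ ^ (k + 2) ∂G) (max |L| |U|) d (fun k => aux_mom hG (k + 2))
  have hQ : 0 < α ^ 2 + ∑' k : ℕ, (∫ μ, μ ^ (k + 2) ∂G) ^ 2 / (Nat.factorial (k + 2) : ℝ) := by
    rcases hne with h | h
    · have : 0 ≤ ∑' k : ℕ, (∫ μ, μ ^ (k + 2) ∂G) ^ 2 / (Nat.factorial (k + 2) : ℝ) :=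
        tsum_nonneg fun k => by positivity
      positivity
    · have h2 : ∫ μ, μ ^ 2 ∂G ≠ 0 := fun h0 => h (aux_dirac hG h0)
      have : 0 < ∑' k : ℕ, (∫ μ, μ ^ (k + 2) ∂G) ^ 2 / (Nat.factorial (k + 2) : ℝ) :=
        (aux_summ_sq hG).tsum_pos (fun k => by positivity) 0 (by
          simp only [zero_add]; positivity)
      positivity
  have l3 := (((l1.const_mul d).const_add (α * Y 1 + ∑' k : ℕ, Y (k + 2) *
    (∫ μ, μ ^ (k + 2) ∂G) / Real.sqrt (Nat.factorial (k + 2))))).div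
    ((l2.const_add (α ^ 2)).sqrt) (Real.sqrt_pos.2 hQ).ne'
  rw [mul_zero, add_zero] at l3
  obtain ⟨σ, hσ, hσd⟩ : ∃ σ : ℝ, |σ| = 1 ∧ d = |d| * σ := by
    rcases le_total 0 d with h | h
    · exact ⟨1, by simp, by rw [abs_of_nonneg h]; ring⟩
    · exact ⟨-1, by simp, by rw [abs_of_nonpos h]; ring⟩
  have l4 : Tendsto (fun ε : ℝ => ε * σ) (𝓝[>] 0) (𝓝 0) := by
    have : Continuous fun ε : ℝ => ε * σ := by fun_prop
    have := this.tendsto 0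
    rw [zero_mul] at this
    exact this.mono_left nhdsWithin_le_nhds
  refine le_of_tendsto (l3.comp l4) ?_
  have hI : Set.Icc L U ∈ 𝓝 (0 : ℝ) := Icc_mem_nhds hL hU
  have e1 := l4.eventually hI
  have e2 : ∀ᶠ ε : ℝ in 𝓝[>] 0, ε < 1 := nhdsWithin_le_nhds (gt_mem_nhds one_pos)
  filter_upwards [e1, e2, self_mem_nhdsWithin] with ε h1 h2 h3
  have h3 : 0 < ε := h3
  have habs : |ε * σ| = ε := by rw [abs_mul, hσ, mul_one, abs_of_pos h3]
  refine hb (aux_mem L U Y hY α G hG hne hs d hd (ε * σ) ?_ ?_ h1 ?_)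
  · rw [← abs_pos, habs]; exact h3
  · rw [habs]; exact h2
  · rw [habs]; linear_combination ε * hσd

lemma aux_Y1 (L U : ℝ) (hL : L < 0) (hU : 0 < U) (Y : ℕ → ℝ) (s : ℝ) (hs : |s| = 1) :
    s * Y 1 ∈ setB L U Y := by
  have h0 : s ≠ 0 := by rintro rfl; simp at hs
  refine ⟨s, Measure.dirac 0, inferInstance, ?_, Or.inl h0, ?_⟩
  · rw [Measure.dirac_apply' _ measurableSet_Icc.compl]
    simp [hL.le, hU.le]
  · simp [Real.sqrt_sq_eq_abs, hs]

lemma aux_Y1' (L U : ℝ) (hL : L < 0) (hU : 0 < U) (Y : ℕ → ℝ)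
    (hY : Summable fun k : ℕ => (Y (k + 2)) ^ 2 / (Nat.factorial (k + 2) : ℝ))
    (s : ℝ) (hs : |s| = 1) (b : ℝ) (hb : b ∈ upperBounds (setA L U Y)) :
    s * Y 1 ≤ b := by
  have h0 : s ≠ 0 := by rintro rfl; simp at hs
  have hsupp : (Measure.dirac (0 : ℝ)) (Set.Icc L U)ᶜ = 0 := by
    rw [Measure.dirac_apply' _ measurableSet_Icc.compl]
    simp [hL.le, hU.le]
  have := aux_limit L U hL hU Y hY s (Measure.dirac 0) hsupp (Or.inl h0)
    (by simpa using summable_zero) b hb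
  simpa [Real.sqrt_sq_eq_abs, hs] using this

lemma aux_ub (L U : ℝ) (hL : L < 0) (hU : 0 < U) (Y : ℕ → ℝ)
    (hY : Summable fun k : ℕ => (Y (k + 2)) ^ 2 / (Nat.factorial (k + 2) : ℝ)) :
    upperBounds (setA L U Y) = upperBounds (setB L U Y) := by
  ext b
  constructor
  · rintro hb r ⟨α, G, hP, hG, hne, rfl⟩
    by_cases hs : Summable fun k : ℕ => Y (k + 2) * (∫ μ, μ ^ (k + 2) ∂G)
        / Real.sqrt (Nat.factorial (k + 2))
    · exact aux_limit L U hL hU Y hY α G hG hne hs b hb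
    · rw [tsum_eq_zero_of_not_summable hs, add_zero]
      have hb1 : |Y 1| ≤ b := abs_le'.2
        ⟨by simpa using aux_Y1' L U hL hU Y hY 1 (by simp) b hb,
         by simpa using aux_Y1' L U hL hU Y hY (-1) (by simp) b hb⟩
      refine le_trans ?_ hb1
      have hq : 0 ≤ ∑' k : ℕ, (∫ μ, μ ^ (k + 2) ∂G) ^ 2 / (Nat.factorial (k + 2) : ℝ) :=
        tsum_nonneg fun k => by positivity
      apply div_le_of_le_mul₀ (Real.sqrt_nonneg _) (abs_nonneg _)
      have h1 : |α| ≤ Real.sqrt (α ^ 2 + ∑' k : ℕ, (∫ μ, μ ^ (k + 2) ∂G) ^ 2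
          / (Nat.factorial (k + 2) : ℝ)) := Real.abs_le_sqrt (by linarith)
      calc α * Y 1 ≤ |α * Y 1| := le_abs_self _
        _ = |Y 1| * |α| := by rw [abs_mul, mul_comm]
        _ ≤ _ := mul_le_mul_of_nonneg_left h1 (abs_nonneg _)
  · rintro hb r ⟨G, hP, hG, hne, rfl⟩
    by_cases hs : Summable fun k : ℕ => Y (k + 2) * (∫ μ, μ ^ (k + 2) ∂G)
        / Real.sqrt (Nat.factorial (k + 2))
    · rw [aux_split_den hG, aux_split_num Y hs]
      exact hb ⟨_, G, hP, hG, Or.inr hne, rfl⟩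
    · have hs' : ¬ Summable fun k : ℕ => Y (k + 1) * (∫ μ, μ ^ (k + 1) ∂G)
          / Real.sqrt (Nat.factorial (k + 1)) := fun h => hs ((summable_nat_add_iff 1).2 h)
      rw [tsum_eq_zero_of_not_summable hs', zero_div]
      have i1 := hb (aux_Y1 L U hL hU Y 1 (by simp))
      have i2 := hb (aux_Y1 L U hL hU Y (-1) (by simp))
      linarith

lemma aux_sSup (A B : Set ℝ) (hB : B.Nonempty) (h : upperBounds A = upperBounds B) :
    sSup A = sSup B := by
  by_cases hb : BddAbove B
  · have hl : IsLUB A (sSup B) := by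
      have := isLUB_csSup hB hb
      rwa [IsLUB, ← h] at this
    have hA : A.Nonempty := by
      by_contra hA
      rw [Set.not_nonempty_iff_eq_empty] at hA
      rw [hA, upperBounds_empty] at h
      obtain ⟨x, hx⟩ := hB
      have : x - 1 ∈ upperBounds B := h ▸ Set.mem_univ _
      linarith [this hx]
    exact hl.csSup_eq hA
  · have ha : ¬ BddAbove A := by rw [BddAbove, h]; exact hb
    rw [Real.sSup_of_not_bddAbove ha, Real.sSup_of_not_bddAbove hb]

/-- Decoupling the first moment in the limiting LRT supremum: for `M = [L,U]` with
`L < 0 < U` and reals `(Y_k)` with `Σ_{k≥2} Y_k²/k! < ∞`, the supremum over probability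
measures `G` on `M` (excluding `δ₀`) of
`(Σ_{k≥1} Y_k κ_k(G)/√(k!)) / (Σ_{k≥1} κ_k(G)²/k!)^{1/2}` equals the supremum over
`α ∈ ℝ` and `G ∈ P_M` of
`(αY₁ + Σ_{k≥2} Y_k κ_k(G)/√(k!)) / (α² + Σ_{k≥2} κ_k(G)²/k!)^{1/2}`. -/
theorem sup_ratio_first_moment_decoupled
    (L U : ℝ) (hL : L < 0) (hU : 0 < U) (Y : ℕ → ℝ)
    (hY : Summable fun k : ℕ => (Y (k + 2)) ^ 2 / (Nat.factorial (k + 2) : ℝ)) :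
    sSup {r : ℝ | ∃ G : Measure ℝ, IsProbabilityMeasure G ∧ G (Set.Icc L U)ᶜ = 0 ∧
        G ≠ Measure.dirac 0 ∧
        r = (∑' k : ℕ, Y (k + 1) * (∫ μ, μ ^ (k + 1) ∂G)
                / Real.sqrt (Nat.factorial (k + 1)))
            / Real.sqrt (∑' k : ℕ, (∫ μ, μ ^ (k + 1) ∂G) ^ 2
                / (Nat.factorial (k + 1) : ℝ))}
      = sSup {r : ℝ | ∃ (α : ℝ) (G : Measure ℝ), IsProbabilityMeasure G ∧
          G (Set.Icc L U)ᶜ = 0 ∧ (α ≠ 0 ∨ G ≠ Measure.dirac 0) ∧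
          r = (α * Y 1 + ∑' k : ℕ, Y (k + 2) * (∫ μ, μ ^ (k + 2) ∂G)
                  / Real.sqrt (Nat.factorial (k + 2)))
              / Real.sqrt (α ^ 2 + ∑' k : ℕ, (∫ μ, μ ^ (k + 2) ∂G) ^ 2
                  / (Nat.factorial (k + 2) : ℝ))} := by
  exact aux_sSup (setA L U Y) (setB L U Y) ⟨_, aux_Y1 L U hL hU Y 1 (by simp)⟩
    (aux_ub L U hL hU Y hY)
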